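/- arXiv:2510.23737 — 5 statements merged into one kernel-verified Lean document; each statement's English description precedes it below -/
import Mathlib

section
/- The primal solution map x* : Θ_f → ℝⁿ, which assigns to each θ ∈ Θ_f the unique minimizer of QP(θ), is continuous on Θ_f. -/
open Matrix

open Filter Topology

/-- If a point of a polyhedral cone has a maximal set of active constraints among the points of
the cone with the same image under `A`, then every direction in the kernel of `A` that keeps the
active constraints active leaves all the constraints unchanged. -/
theorem eq_zero_of_maximal_active {E F ι : Type*} [AddCommGroup E] [Module ℝ E]
    [AddCommGroup F] [Module ℝ F] [Finite ι] (A : E →ₗ[ℝ] F) (a : ι → E →ₗ[ℝ] ℝ) {x : E}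
    (hx : ∀ i, a i x ≤ 0)
    (hmax : ∀ y, (∀ i, a i y ≤ 0) → A y = A x → (∀ i, a i x = 0 → a i y = 0) →
      ∀ i, a i y = 0 → a i x = 0)
    {z : E} (hz : A z = 0) (hzx : ∀ i, a i x = 0 → a i z = 0) (i : ι) : a i z = 0 := by
  have key : ∀ z : E, A z = 0 → (∀ i, a i x = 0 → a i z = 0) → ∀ i, a i z ≤ 0 := by
    intro z hz hzx i
    by_contra! hi
    obtain ⟨j, hj, hmin⟩ := Set.exists_min_image {j | 0 < a j z} (fun j => -a j x / a j z)
      (Set.toFinite _) ⟨i, hi⟩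
    have hj' : 0 < a j z := hj
    set t := -a j x / a j z with ht
    have ht0 : 0 ≤ t := div_nonneg (by linarith [hx j]) hj'.le
    have hjt : a j (x + t • z) = 0 := by
      simp only [map_add, map_smul, smul_eq_mul, ht]
      field_simp
      ring
    refine hj'.ne' (hzx j (hmax (x + t • z) (fun k => ?_) (by simp [hz]) (fun k hk => ?_) j hjt))
    · simp only [map_add, map_smul, smul_eq_mul]
      rcases lt_or_ge 0 (a k z) with hk | hk
      · have := (le_div_iff₀ hk).1 (hmin k hk)
        linarith
      · linarith [hx k, mul_nonpos_of_nonneg_of_nonpos ht0 hk]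
    · simp [hk, hzx k hk]
  refine le_antisymm (key z hz hzx i) ?_
  have := key (-z) (by simp [hz]) (fun i hi => by simp [hzx i hi]) i
  simpa using this

/-- A linear map has a linear generalized inverse. -/
theorem LinearMap.exists_generalized_inverse {K V W : Type*} [Field K] [AddCommGroup V]
    [Module K V] [AddCommGroup W] [Module K W] (f : V →ₗ[K] W) :
    ∃ g : W →ₗ[K] V, ∀ v, f (g (f v)) = f v := by
  obtain ⟨h, hh⟩ := f.rangeRestrict.exists_rightInverse_of_surjective f.range_rangeRestrict
  obtain ⟨g, hg⟩ := h.exists_extend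
  refine ⟨g, fun v => ?_⟩
  have h1 : g (f v) = h (f.rangeRestrict v) := LinearMap.congr_fun hg (f.rangeRestrict v)
  have h2 := LinearMap.congr_fun hh (f.rangeRestrict v)
  rw [h1]
  exact congrArg Subtype.val h2

/-- Every point of the image of a polyhedral cone under a linear map has a preimage in the cone
whose norm is controlled linearly. -/
theorem exists_norm_le_of_polyhedral_cone {E F ι : Type*} [NormedAddCommGroup E]
    [NormedSpace ℝ E] [NormedAddCommGroup F] [NormedSpace ℝ F] [FiniteDimensional ℝ F]
    [Finite ι] (A : E →ₗ[ℝ] F) (a : ι → E →ₗ[ℝ] ℝ) :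
    ∃ c : ℝ, ∀ d, (∀ i, a i d ≤ 0) →
      ∃ d', (∀ i, a i d' ≤ 0) ∧ A d' = A d ∧ ‖d'‖ ≤ c * ‖A d‖ := by
  classical
  have := Fintype.ofFinite ι
  let V : Set ι → Submodule ℝ E := fun J => ⨅ i ∈ J, LinearMap.ker (a i)
  have hV : ∀ J x, x ∈ V J ↔ ∀ i ∈ J, a i x = 0 := fun J x => by simp [V]
  choose g hg using fun J => (A.domRestrict (V J)).exists_generalized_inverse
  let G : Set ι → F →L[ℝ] E := fun J => LinearMap.toContinuousLinearMap ((V J).subtype ∘ₗ g J)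
  refine ⟨∑ J, ‖G J‖, fun d hd => ?_⟩
  let S : Set E := {y | (∀ i, a i y ≤ 0) ∧ A y = A d}
  obtain ⟨x, ⟨hxa, hxA⟩, hxm⟩ := Set.Finite.exists_maximalFor'
    (fun y => {i | a i y = 0}) S (Set.toFinite _) ⟨d, hd, rfl⟩
  set J : Set ι := {i | a i x = 0} with hJ
  have hxV : x ∈ V J := (hV J x).2 fun i hi => hi
  have hGV : G J (A d) ∈ V J := (g J (A d)).2
  have hGA : A (G J (A d)) = A d := by
    rw [← hxA]
    exact hg J ⟨x, hxV⟩
  refine ⟨G J (A d), fun i => ?_, hGA, ?_⟩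
  · have := eq_zero_of_maximal_active A a hxa
      (fun y hy hyx hxy i hi => hxm (j := y) ⟨hy, hyx.trans hxA⟩ hxy hi)
      (z := G J (A d) - x) (by rw [map_sub, hGA, hxA, sub_self])
      (fun i hi => (hV J _).1 ((V J).sub_mem hGV hxV) i hi) i
    rw [map_sub] at this
    linarith [hxa i]
  · refine ((G J).le_opNorm _).trans (mul_le_mul_of_nonneg_right ?_ (norm_nonneg _))
    exact Finset.single_le_sum (f := fun J => ‖G J‖) (fun _ _ => norm_nonneg _)
      (Finset.mem_univ J)

/-- Lower semicontinuity, relative to the feasible parameters, of a polyhedral feasible set with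
respect to the right-hand side of its equality constraints. -/
theorem eventually_exists_feasible_mem {n m₁ m₂ : Type*} [Fintype n] [Fintype m₁] [Fintype m₂]
    (Ae : Matrix m₁ n ℝ) (be : m₁ → ℝ) (AC : Matrix m₂ n ℝ) (bC : m₂ → ℝ) {θ₀ : m₁ → ℝ}
    {x₀ : n → ℝ} (hx₀ : Ae *ᵥ x₀ = be + θ₀) (hx₀' : AC *ᵥ x₀ ≤ bC) {U : Set (n → ℝ)}
    (hU : U ∈ 𝓝 x₀) :
    ∀ᶠ θ in 𝓝 θ₀, (∃ y, Ae *ᵥ y = be + θ ∧ AC *ᵥ y ≤ bC) →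
      ∃ y ∈ U, Ae *ᵥ y = be + θ ∧ AC *ᵥ y ≤ bC := by
  have hcont : ∀ i, Continuous fun x : n → ℝ => (AC *ᵥ x) i := fun i =>
    (continuous_apply i).comp (Continuous.matrix_mulVec continuous_const continuous_id)
  have hW : ∀ᶠ x in 𝓝 x₀, x ∈ U ∧ ∀ i, (AC *ᵥ x₀) i < bC i → (AC *ᵥ x) i < bC i := by
    refine (eventually_mem_set.2 hU).and (eventually_all.2 fun i => ?_)
    by_cases hi : (AC *ᵥ x₀) i < bC i
    · filter_upwards [(hcont i).continuousAt.eventually_lt continuousAt_const hi] with x hx _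
      exact hx
    · exact Eventually.of_forall fun x h => absurd h hi
  obtain ⟨c, hc⟩ := exists_norm_le_of_polyhedral_cone Ae.mulVecLin
    fun i : {i // (AC *ᵥ x₀) i = bC i} => LinearMap.proj i.1 ∘ₗ AC.mulVecLin
  obtain ⟨ε, hε, hball⟩ := Metric.eventually_nhds_iff.1 hW
  have hsmall : ∀ᶠ θ in 𝓝 θ₀, c * ‖θ - θ₀‖ < ε := by
    have : Continuous fun θ : m₁ → ℝ => c * ‖θ - θ₀‖ := by fun_prop
    exact this.continuousAt.eventually_lt continuousAt_const (by simpa using hε)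
  filter_upwards [hsmall] with θ hθ
  rintro ⟨y, hye, hyC⟩
  have hd : Ae *ᵥ (y - x₀) = θ - θ₀ := by rw [mulVec_sub, hye, hx₀]; abel
  obtain ⟨d, hda, hdA, hdn⟩ := hc (y - x₀) fun i => by
    have := hyC i.1
    simp only [LinearMap.comp_apply, LinearMap.proj_apply, mulVecLin_apply, mulVec_sub,
      Pi.sub_apply, i.2]
    linarith
  simp only [LinearMap.comp_apply, LinearMap.proj_apply, mulVecLin_apply, hd] at hda hdA hdn
  obtain ⟨hdU, hdi⟩ := hball (y := x₀ + d) (by simpa using hdn.trans_lt hθ)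
  refine ⟨x₀ + d, hdU, by rw [mulVec_add, hx₀, hdA]; abel, fun i => ?_⟩
  rcases (hx₀' i).lt_or_eq with hi | hi
  · exact (hdi i hi).le
  · rw [mulVec_add, Pi.add_apply, hi]
    linarith [hda ⟨i, hi⟩]

/-- A positive definite quadratic form dominates a multiple of the squared norm. -/
theorem Matrix.PosDef.exists_pos_mul_norm_sq_le {n : Type*} [Fintype n] {Q : Matrix n n ℝ}
    (hQ : Q.PosDef) : ∃ μ > 0, ∀ x : n → ℝ, μ * ‖x‖ ^ 2 ≤ x ⬝ᵥ Q *ᵥ x := by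
  have hpos : ∀ x : n → ℝ, x ≠ 0 → 0 < x ⬝ᵥ Q *ᵥ x := fun x hx => by
    simpa using hQ.dotProduct_mulVec_pos hx
  have hcont : Continuous fun x : n → ℝ => x ⬝ᵥ Q *ᵥ x :=
    continuous_id.dotProduct (Continuous.matrix_mulVec continuous_const continuous_id)
  have hunit : ∀ x : n → ℝ, x ≠ 0 → ‖x‖⁻¹ • x ∈ Metric.sphere (0 : n → ℝ) 1 := fun x hx => by
    simp [norm_smul, hx]
  rcases (Metric.sphere (0 : n → ℝ) 1).eq_empty_or_nonempty with h | h
  · refine ⟨1, one_pos, fun x => ?_⟩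
    by_cases hx : x = 0
    · simp [hx]
    · exact absurd (hunit x hx) (by simp [h])
  · obtain ⟨u, hu, hmin⟩ := (isCompact_sphere (0 : n → ℝ) 1).exists_isMinOn h hcont.continuousOn
    refine ⟨u ⬝ᵥ Q *ᵥ u, hpos u (ne_zero_of_mem_unit_sphere ⟨u, hu⟩), fun x => ?_⟩
    by_cases hx : x = 0
    · simp [hx]
    · have h1 : u ⬝ᵥ Q *ᵥ u ≤ (‖x‖⁻¹ • x) ⬝ᵥ Q *ᵥ (‖x‖⁻¹ • x) := hmin (hunit x hx)
      have hx' : 0 < ‖x‖ := norm_pos_iff.2 hx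
      rw [mulVec_smul, smul_dotProduct, dotProduct_smul, smul_eq_mul, smul_eq_mul] at h1
      calc u ⬝ᵥ Q *ᵥ u * ‖x‖ ^ 2 ≤ ‖x‖⁻¹ * (‖x‖⁻¹ * x ⬝ᵥ Q *ᵥ x) * ‖x‖ ^ 2 := by gcongr
        _ = x ⬝ᵥ Q *ᵥ x := by field_simp

/-- The sublevel sets of a quadratic function with positive definite quadratic part are
compact. -/
theorem Matrix.PosDef.isCompact_sublevel {n : Type*} [Fintype n] {Q : Matrix n n ℝ}
    (hQ : Q.PosDef) (C : n → ℝ) (M : ℝ) :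
    IsCompact {x : n → ℝ | x ⬝ᵥ Q *ᵥ x + C ⬝ᵥ x ≤ M} := by
  obtain ⟨μ, hμ, hle⟩ := hQ.exists_pos_mul_norm_sq_le
  have hcont : Continuous fun x : n → ℝ => x ⬝ᵥ Q *ᵥ x + C ⬝ᵥ x :=
    (continuous_id.dotProduct (Continuous.matrix_mulVec continuous_const continuous_id)).add
      (continuous_const.dotProduct continuous_id)
  refine Metric.isCompact_of_isClosed_isBounded (isClosed_le hcont continuous_const)
    (isBounded_iff_forall_norm_le.2 ⟨(∑ i, |C i|) / μ + |M| / μ + 1, fun x hx => ?_⟩)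
  have hx' : x ⬝ᵥ Q *ᵥ x + C ⬝ᵥ x ≤ M := hx
  have hC : -((∑ i, |C i|) * ‖x‖) ≤ C ⬝ᵥ x := by
    refine (abs_le.1 ?_).1
    rw [Finset.sum_mul]
    refine (Finset.abs_sum_le_sum_abs _ _).trans (Finset.sum_le_sum fun i _ => ?_)
    rw [abs_mul]
    exact mul_le_mul_of_nonneg_left (norm_le_pi_norm x i) (abs_nonneg _)
  have hκ : 0 ≤ ∑ i, |C i| := Finset.sum_nonneg fun i _ => abs_nonneg _
  by_contra! hlt
  have h1 : ∑ i, |C i| + |M| + μ < μ * ‖x‖ := by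
    calc ∑ i, |C i| + |M| + μ = μ * ((∑ i, |C i|) / μ + |M| / μ + 1) := by field_simp
      _ < μ * ‖x‖ := by gcongr
  have h2 : 1 < ‖x‖ := by
    have : 0 ≤ (∑ i, |C i|) / μ + |M| / μ := by positivity
    linarith
  nlinarith [hle x, le_abs_self M, abs_nonneg M]

/-- A quadratic function with positive definite quadratic part has at most one minimizer on a
convex set. -/
theorem Matrix.PosDef.eq_of_forall_le {n : Type*} [Fintype n] {Q : Matrix n n ℝ}
    (hQ : Q.PosDef) (C : n → ℝ) {s : Set (n → ℝ)} (hs : Convex ℝ s) {x y : n → ℝ} (hx : x ∈ s)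
    (hy : y ∈ s) (hmin : ∀ z ∈ s, x ⬝ᵥ Q *ᵥ x + C ⬝ᵥ x ≤ z ⬝ᵥ Q *ᵥ z + C ⬝ᵥ z)
    (hle : y ⬝ᵥ Q *ᵥ y + C ⬝ᵥ y ≤ x ⬝ᵥ Q *ᵥ x + C ⬝ᵥ x) : y = x := by
  by_contra hne
  have hpos : 0 < (y - x) ⬝ᵥ Q *ᵥ (y - x) := by
    simpa using hQ.dotProduct_mulVec_pos (sub_ne_zero.2 hne)
  have hmid := hmin _ (hs hx hy (a := 1 / 2) (b := 1 / 2) (by norm_num) (by norm_num)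
    (by norm_num))
  simp only [mulVec_add, mulVec_sub, mulVec_smul, dotProduct_add, add_dotProduct, sub_dotProduct,
    dotProduct_sub, smul_dotProduct, dotProduct_smul, smul_eq_mul] at hpos hmid
  linarith

/-- The primal solution map `θ ↦ x*(θ)`, assigning to each feasible parameter
the unique minimizer of `QP(θ)`, is continuous on the feasible parameter set. -/
theorem qp_solution_map_continuousOn
    (n m₁ m₂ : ℕ)
    (Q : Matrix (Fin n) (Fin n) ℝ) (hQ : Q.PosDef)
    (C : Fin n → ℝ)
    (Ae : Matrix (Fin m₁) (Fin n) ℝ) (be : Fin m₁ → ℝ)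
    (AC : Matrix (Fin m₂) (Fin n) ℝ) (bC : Fin m₂ → ℝ)
    (X : (Fin m₁ → ℝ) → Set (Fin n → ℝ))
    (hX : ∀ θ, X θ = {x : Fin n → ℝ | Ae.mulVec x = be + θ ∧ AC.mulVec x ≤ bC})
    (f : (Fin n → ℝ) → ℝ)
    (hf : ∀ x, f x = x ⬝ᵥ Q.mulVec x + C ⬝ᵥ x)
    (Θf : Set (Fin m₁ → ℝ)) (hΘf : Θf = {θ : Fin m₁ → ℝ | (X θ).Nonempty})
    (xstar : (Fin m₁ → ℝ) → (Fin n → ℝ))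
    (hxstar : ∀ θ ∈ Θf, xstar θ ∈ X θ ∧ ∀ y ∈ X θ, f (xstar θ) ≤ f y) :
    ContinuousOn xstar Θf := by
  intro θ₀ hθ₀
  have hmem : ∀ θ x, x ∈ X θ ↔ Ae *ᵥ x = be + θ ∧ AC *ᵥ x ≤ bC := fun θ x => by rw [hX]; rfl
  obtain ⟨hx₀, hmin⟩ := hxstar θ₀ hθ₀
  have hmulVec : ∀ {m : ℕ} (A : Matrix (Fin m) (Fin n) ℝ), Continuous fun x => A *ᵥ x :=
    fun A => Continuous.matrix_mulVec continuous_const continuous_id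
  have hcont : Continuous f := by
    rw [funext hf]
    exact (continuous_id.dotProduct (hmulVec Q)).add (continuous_const.dotProduct continuous_id)
  have hupper : ∀ ε > 0, ∀ᶠ θ in 𝓝[Θf] θ₀, f (xstar θ) ≤ f (xstar θ₀) + ε := by
    intro ε hε
    have hU : {x | f x < f (xstar θ₀) + ε} ∈ 𝓝 (xstar θ₀) :=
      hcont.continuousAt.eventually_lt continuousAt_const (by linarith)
    filter_upwards [nhdsWithin_le_nhds (eventually_exists_feasible_mem Ae be AC bC
      ((hmem _ _).1 hx₀).1 ((hmem _ _).1 hx₀).2 hU), self_mem_nhdsWithin] with θ hθ hθf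
    obtain ⟨y, hyU, hy⟩ := hθ ⟨xstar θ, (hmem _ _).1 (hxstar θ hθf).1⟩
    exact ((hxstar θ hθf).2 y ((hmem _ _).2 hy)).trans (le_of_lt hyU)
  have hcompact : IsCompact {x | f x ≤ f (xstar θ₀) + 1} := by
    simpa only [hf] using hQ.isCompact_sublevel C (f (xstar θ₀) + 1)
  refine hcompact.tendsto_nhds_of_unique_mapClusterPt (hupper 1 one_pos) fun x _ hx => ?_
  obtain ⟨U, hUle, hUx⟩ := mapClusterPt_iff_ultrafilter.1 hx
  have hUfeas : ∀ᶠ θ in (U : Filter (Fin m₁ → ℝ)), xstar θ ∈ X θ :=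
    hUle (eventually_mem_nhdsWithin.mono fun θ hθ => (hxstar θ hθ).1)
  have hUid : Tendsto (fun θ => be + θ) U (𝓝 (be + θ₀)) :=
    tendsto_const_nhds.add (hUle.trans nhdsWithin_le_nhds)
  have hxX : x ∈ X θ₀ := by
    refine (hmem _ _).2 ⟨tendsto_nhds_unique (((hmulVec Ae).tendsto x).comp hUx) (hUid.congr' ?_),
      le_of_tendsto (((hmulVec AC).tendsto x).comp hUx) ?_⟩
    · exact hUfeas.mono fun θ hθ => ((hmem _ _).1 hθ).1.symm
    · exact hUfeas.mono fun θ hθ => ((hmem _ _).1 hθ).2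
  have hfx : f x ≤ f (xstar θ₀) := le_of_forall_pos_le_add fun ε hε =>
    le_of_tendsto ((hcont.tendsto x).comp hUx) (hUle (hupper ε hε))
  have hconv : Convex ℝ (X θ₀) := by
    rw [hX]
    exact ((convex_singleton (be + θ₀)).linear_preimage Ae.mulVecLin).inter
      ((convex_Iic bC).linear_preimage AC.mulVecLin)
  simp only [hf] at hmin hfx
  exact hQ.eq_of_forall_le C hconv hx₀ hxX hmin hfx
end

section
/- The primal solution map x* : Θ_f → ℝⁿ is piecewise linear: there exist K ∈ ℕ, convex sets R₁, …, R_K ⊆ ℝ^{m₁} with Θ_f = R₁ ∪ ⋯ ∪ R_K, matrices M₁, …, M_K ∈ ℝ^{n×m₁} and vectors c₁, …, c_K ∈ ℝⁿ such that for every j and every θ ∈ R_j, x*(θ) = M_j θ + c_j. -/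
open Matrix

open Filter Topology

section QuadraticProgram

variable {ι κ μ : Type*} [Fintype ι] {Q : Matrix ι ι ℝ} {C : ι → ℝ} {Ae : Matrix κ ι ℝ}
  {AC : Matrix μ ι ℝ} {b : κ → ℝ} {bC : μ → ℝ} {x y d : ι → ℝ}

/-- The objective `x ↦ xᵀQx + Cᵀx` of a quadratic program. -/
def quadObjective (Q : Matrix ι ι ℝ) (C x : ι → ℝ) : ℝ := x ⬝ᵥ Q *ᵥ x + C ⬝ᵥ x

/-- The gradient of `quadObjective Q C` at `x`, for symmetric `Q`. -/
def quadGradient (Q : Matrix ι ι ℝ) (C x : ι → ℝ) : ι → ℝ := (2 : ℝ) • Q *ᵥ x + C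

/-- The polyhedron `{x | Ae x = b, AC x ≤ bC}`. -/
def polyhedron (Ae : Matrix κ ι ℝ) (b : κ → ℝ) (AC : Matrix μ ι ℝ) (bC : μ → ℝ) :
    Set (ι → ℝ) :=
  {x | Ae *ᵥ x = b ∧ AC *ᵥ x ≤ bC}

/-- The indices of the inequality constraints that hold with equality at `x`. -/
def activeSet (AC : Matrix μ ι ℝ) (bC : μ → ℝ) (x : ι → ℝ) : Set μ :=
  {i | (AC *ᵥ x) i = bC i}

/-- The cone of directions `d` with `Ae d = 0` and `(AC d) i ≤ 0` for `i ∈ A`. -/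
def directionCone (Ae : Matrix κ ι ℝ) (AC : Matrix μ ι ℝ) (A : Set μ) : Set (ι → ℝ) :=
  {d | Ae *ᵥ d = 0 ∧ ∀ i ∈ A, (AC *ᵥ d) i ≤ 0}

/-- Differences of optimal solutions that share the active set `A` lie in this subspace. -/
def solutionDirections (Q : Matrix ι ι ℝ) (Ae : Matrix κ ι ℝ) (AC : Matrix μ ι ℝ) (A : Set μ) :
    Submodule ℝ (ι → ℝ) where
  carrier := {x | (∀ i ∈ A, (AC *ᵥ x) i = 0) ∧
    ∀ d, Ae *ᵥ d = 0 → (∀ i ∈ A, (AC *ᵥ d) i = 0) → Q *ᵥ x ⬝ᵥ d = 0}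
  zero_mem' := by simp
  add_mem' := by
    rintro x y ⟨hx, hx'⟩ ⟨hy, hy'⟩
    refine ⟨fun i hi ↦ ?_, fun d h h' ↦ ?_⟩
    · simp [mulVec_add, hx i hi, hy i hi]
    · simp [mulVec_add, add_dotProduct, hx' d h h', hy' d h h']
  smul_mem' := by
    rintro a x ⟨hx, hx'⟩
    refine ⟨fun i hi ↦ ?_, fun d h h' ↦ ?_⟩
    · simp [mulVec_smul, hx i hi]
    · simp [mulVec_smul, smul_dotProduct, hx' d h h']

lemma quadObjective_add (hQ : Q.IsHermitian) (x d : ι → ℝ) :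
    quadObjective Q C (x + d) =
      quadObjective Q C x + quadGradient Q C x ⬝ᵥ d + d ⬝ᵥ Q *ᵥ d := by
  have hsymm : x ⬝ᵥ Q *ᵥ d = Q *ᵥ x ⬝ᵥ d := by
    rw [dotProduct_mulVec, ← mulVec_transpose, ← conjTranspose_eq_transpose_of_trivial, hQ.eq]
  simp only [quadObjective, quadGradient, mulVec_add, add_dotProduct, dotProduct_add,
    smul_dotProduct, smul_eq_mul, hsymm, dotProduct_comm d (Q *ᵥ x)]
  ring

lemma sub_mem_directionCone (hx : x ∈ polyhedron Ae b AC bC) (hy : y ∈ polyhedron Ae b AC bC) :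
    y - x ∈ directionCone Ae AC (activeSet AC bC x) := by
  refine ⟨by simp [mulVec_sub, hx.1, hy.1], fun i hi ↦ ?_⟩
  simpa [mulVec_sub, show (AC *ᵥ x) i = bC i from hi] using hy.2 i

lemma directionCone_eventually_feasible [Finite μ] (hx : x ∈ polyhedron Ae b AC bC)
    (hd : d ∈ directionCone Ae AC (activeSet AC bC x)) :
    ∀ᶠ t in 𝓝[>] (0 : ℝ), x + t • d ∈ polyhedron Ae b AC bC := by
  have hineq : ∀ i, ∀ᶠ t in 𝓝[>] (0 : ℝ), (AC *ᵥ (x + t • d)) i ≤ bC i := by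
    intro i
    simp only [mulVec_add, mulVec_smul, Pi.add_apply, Pi.smul_apply, smul_eq_mul]
    by_cases hi : i ∈ activeSet AC bC x
    · filter_upwards [self_mem_nhdsWithin] with t ht
      have := mul_nonpos_of_nonneg_of_nonpos (le_of_lt ht) (hd.2 i hi)
      linarith [hx.2 i]
    · have hlt : (AC *ᵥ x) i < bC i := lt_of_le_of_ne (hx.2 i) hi
      have hcont : Tendsto (fun t : ℝ ↦ (AC *ᵥ x) i + t * (AC *ᵥ d) i) (𝓝 0)
          (𝓝 ((AC *ᵥ x) i + 0 * (AC *ᵥ d) i)) :=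
        Continuous.tendsto (by fun_prop) 0
      rw [zero_mul, add_zero] at hcont
      exact ((hcont.mono_left nhdsWithin_le_nhds).eventually_lt_const hlt).mono fun _ ↦ le_of_lt
  filter_upwards [eventually_all.2 hineq] with t ht
  exact ⟨by simp [mulVec_add, mulVec_smul, hx.1, hd.1], ht⟩

/-- First-order optimality for a convex quadratic program. -/
lemma isMinOn_quadObjective_iff [Finite μ] (hQ : Q.PosSemidef)
    (hx : x ∈ polyhedron Ae b AC bC) :
    IsMinOn (quadObjective Q C) (polyhedron Ae b AC bC) x ↔
      ∀ d ∈ directionCone Ae AC (activeSet AC bC x), 0 ≤ quadGradient Q C x ⬝ᵥ d := by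
  refine ⟨fun hmin d hd ↦ ?_, fun h y hy ↦ ?_⟩
  · have hev : ∀ᶠ t in 𝓝[>] (0 : ℝ), 0 ≤ quadGradient Q C x ⬝ᵥ d + t * (d ⬝ᵥ Q *ᵥ d) := by
      filter_upwards [directionCone_eventually_feasible hx hd, self_mem_nhdsWithin] with t ht ht0
      have hle := isMinOn_iff.1 hmin _ ht
      rw [quadObjective_add hQ.1] at hle
      simp only [mulVec_smul, dotProduct_smul, smul_dotProduct, smul_eq_mul] at hle
      refine nonneg_of_mul_nonneg_right (a := t) ?_ ht0
      linarith
    have hcont : Tendsto (fun t : ℝ ↦ quadGradient Q C x ⬝ᵥ d + t * (d ⬝ᵥ Q *ᵥ d)) (𝓝 0)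
        (𝓝 (quadGradient Q C x ⬝ᵥ d + 0 * (d ⬝ᵥ Q *ᵥ d))) :=
      Continuous.tendsto (by fun_prop) 0
    rw [zero_mul, add_zero] at hcont
    exact ge_of_tendsto (hcont.mono_left nhdsWithin_le_nhds) hev
  · have hd := sub_mem_directionCone hx hy
    have hexp := quadObjective_add (C := C) hQ.1 x (y - x)
    have hpsd := hQ.dotProduct_mulVec_nonneg (y - x)
    rw [star_trivial] at hpsd
    rw [add_sub_cancel] at hexp
    simp only [Set.mem_ofPred_eq]
    linarith [h _ hd]

/-- A positive definite quadratic program has at most one solution. -/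
lemma eq_of_isMinOn_quadObjective [Finite μ] (hQ : Q.PosDef)
    (hx : x ∈ polyhedron Ae b AC bC) (hy : y ∈ polyhedron Ae b AC bC)
    (hxmin : IsMinOn (quadObjective Q C) (polyhedron Ae b AC bC) x)
    (hymin : IsMinOn (quadObjective Q C) (polyhedron Ae b AC bC) y) : x = y := by
  have hd := sub_mem_directionCone hx hy
  by_contra hne
  have hgrad := (isMinOn_quadObjective_iff hQ.posSemidef hx).1 hxmin _ hd
  have hexp := quadObjective_add (C := C) hQ.1 x (y - x)
  have hpos := hQ.dotProduct_mulVec_pos (sub_ne_zero.2 (Ne.symm hne))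
  rw [star_trivial] at hpos
  rw [add_sub_cancel] at hexp
  linarith [isMinOn_iff.1 hymin x hx]

/-- Convex combinations of optimal solutions with equal active sets are optimal, with the same
active set. -/
lemma isMinOn_quadObjective_combo [Finite μ] (hQ : Q.PosSemidef) {b' : κ → ℝ}
    (hx : x ∈ polyhedron Ae b AC bC) (hy : y ∈ polyhedron Ae b' AC bC)
    (hxmin : IsMinOn (quadObjective Q C) (polyhedron Ae b AC bC) x)
    (hymin : IsMinOn (quadObjective Q C) (polyhedron Ae b' AC bC) y)
    (hA : activeSet AC bC x = activeSet AC bC y)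
    {s t : ℝ} (hs : 0 ≤ s) (ht : 0 ≤ t) (hst : s + t = 1) :
    s • x + t • y ∈ polyhedron Ae (s • b + t • b') AC bC ∧
      activeSet AC bC (s • x + t • y) = activeSet AC bC x ∧
      IsMinOn (quadObjective Q C) (polyhedron Ae (s • b + t • b') AC bC) (s • x + t • y) := by
  have hb (i : μ) : bC i = s * bC i + t * bC i := by rw [← add_mul, hst, one_mul]
  have hmem : s • x + t • y ∈ polyhedron Ae (s • b + t • b') AC bC := by
    refine ⟨by simp [mulVec_add, mulVec_smul, hx.1, hy.1], fun i ↦ ?_⟩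
    simp only [mulVec_add, mulVec_smul, Pi.add_apply, Pi.smul_apply, smul_eq_mul]
    rw [hb i]
    gcongr
    exacts [hx.2 i, hy.2 i]
  have hact : activeSet AC bC (s • x + t • y) = activeSet AC bC x := by
    ext i
    have hiff : (AC *ᵥ x) i = bC i ↔ (AC *ᵥ y) i = bC i := Set.ext_iff.1 hA i
    simp only [activeSet, Set.mem_ofPred_eq, mulVec_add, mulVec_smul, Pi.add_apply, Pi.smul_apply,
      smul_eq_mul]
    refine ⟨fun h ↦ ?_, fun h ↦ by rw [h, hiff.1 h, ← hb]⟩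
    by_contra hne
    have hxlt := lt_of_le_of_ne (hx.2 i) hne
    have hylt := lt_of_le_of_ne (hy.2 i) (mt hiff.2 hne)
    rcases hs.eq_or_lt with rfl | hs
    · rw [zero_add] at hst
      subst hst
      linarith
    · linarith [hb i, mul_lt_mul_of_pos_left hxlt hs, mul_le_mul_of_nonneg_left hylt.le ht]
  refine ⟨hmem, hact, (isMinOn_quadObjective_iff hQ hmem).2 fun d hd ↦ ?_⟩
  rw [hact] at hd
  have hgx := (isMinOn_quadObjective_iff hQ hx).1 hxmin d hd
  have hgy := (isMinOn_quadObjective_iff hQ hy).1 hymin d (hA ▸ hd)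
  have hgrad : quadGradient Q C (s • x + t • y) =
      s • quadGradient Q C x + t • quadGradient Q C y := by
    obtain rfl : t = 1 - s := by linarith
    simp only [quadGradient, mulVec_add, mulVec_smul]
    module
  rw [hgrad, add_dotProduct, smul_dotProduct, smul_dotProduct]
  exact add_nonneg (smul_nonneg hs hgx) (smul_nonneg ht hgy)

lemma quadGradient_dotProduct_eq_zero [Finite μ] (hQ : Q.PosSemidef)
    (hx : x ∈ polyhedron Ae b AC bC)
    (hmin : IsMinOn (quadObjective Q C) (polyhedron Ae b AC bC) x)
    (hd : Ae *ᵥ d = 0) (hd' : ∀ i ∈ activeSet AC bC x, (AC *ᵥ d) i = 0) :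
    quadGradient Q C x ⬝ᵥ d = 0 := by
  have hgrad := (isMinOn_quadObjective_iff hQ hx).1 hmin
  have hpos := hgrad d ⟨hd, fun i hi ↦ (hd' i hi).le⟩
  have hneg := hgrad (-d) ⟨by simp [mulVec_neg, hd], fun i hi ↦ by simp [mulVec_neg, hd' i hi]⟩
  rw [dotProduct_neg] at hneg
  linarith

lemma sub_mem_solutionDirections [Finite μ] (hQ : Q.PosSemidef) {b' : κ → ℝ}
    (hx : x ∈ polyhedron Ae b AC bC) (hy : y ∈ polyhedron Ae b' AC bC)
    (hxmin : IsMinOn (quadObjective Q C) (polyhedron Ae b AC bC) x)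
    (hymin : IsMinOn (quadObjective Q C) (polyhedron Ae b' AC bC) y)
    (hA : activeSet AC bC x = activeSet AC bC y) :
    x - y ∈ solutionDirections Q Ae AC (activeSet AC bC y) := by
  refine ⟨fun i hi ↦ ?_, fun d hd hd' ↦ ?_⟩
  · have hix : i ∈ activeSet AC bC x := hA.symm ▸ hi
    have hiy : (AC *ᵥ y) i = bC i := hi
    simp [mulVec_sub, show (AC *ᵥ x) i = bC i from hix, hiy]
  · have hgx := quadGradient_dotProduct_eq_zero hQ hx hxmin hd (hA.symm ▸ hd')
    have hgy := quadGradient_dotProduct_eq_zero hQ hy hymin hd hd'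
    simp only [quadGradient, add_dotProduct, smul_dotProduct, smul_eq_mul] at hgx hgy
    rw [mulVec_sub, sub_dotProduct]
    linarith

/-- On `solutionDirections`, the equality constraint matrix has a linear left inverse. -/
lemma exists_leftInverse_on_solutionDirections [Fintype κ] [DecidableEq κ] (hQ : Q.PosDef)
    (A : Set μ) :
    ∃ M : Matrix ι κ ℝ, ∀ x ∈ solutionDirections Q Ae AC A, M *ᵥ (Ae *ᵥ x) = x := by
  have hker : LinearMap.ker (Ae.mulVecLin ∘ₗ (solutionDirections Q Ae AC A).subtype) = ⊥ := by
    refine LinearMap.ker_eq_bot'.2 fun x hx ↦ ?_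
    by_contra hne
    have hpos := hQ.dotProduct_mulVec_pos (x := (x : ι → ℝ)) (by simpa using hne)
    rw [star_trivial, dotProduct_comm, x.2.2 x hx x.2.1] at hpos
    exact hpos.false
  obtain ⟨G, hG⟩ := LinearMap.exists_leftInverse_of_injective _ hker
  refine ⟨LinearMap.toMatrix' ((solutionDirections Q Ae AC A).subtype ∘ₗ G), fun x hx ↦ ?_⟩
  rw [LinearMap.toMatrix'_mulVec]
  exact congrArg Subtype.val (LinearMap.congr_fun hG ⟨x, hx⟩)

end QuadraticProgram

/-- The primal solution map `θ ↦ x*(θ)` of the mp-QP is piecewise linear: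
the feasible parameter set is a finite union of convex regions on each of
which `x*` is affine. -/
theorem qp_solution_map_piecewise_linear
    (n m₁ m₂ : ℕ)
    (Q : Matrix (Fin n) (Fin n) ℝ) (hQ : Q.PosDef)
    (C : Fin n → ℝ)
    (Ae : Matrix (Fin m₁) (Fin n) ℝ) (be : Fin m₁ → ℝ)
    (AC : Matrix (Fin m₂) (Fin n) ℝ) (bC : Fin m₂ → ℝ)
    (X : (Fin m₁ → ℝ) → Set (Fin n → ℝ))
    (hX : ∀ θ, X θ = {x : Fin n → ℝ | Ae.mulVec x = be + θ ∧ AC.mulVec x ≤ bC})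
    (f : (Fin n → ℝ) → ℝ)
    (hf : ∀ x, f x = x ⬝ᵥ Q.mulVec x + C ⬝ᵥ x)
    (Θf : Set (Fin m₁ → ℝ)) (hΘf : Θf = {θ : Fin m₁ → ℝ | (X θ).Nonempty})
    (xstar : (Fin m₁ → ℝ) → (Fin n → ℝ))
    (hxstar : ∀ θ ∈ Θf, xstar θ ∈ X θ ∧ ∀ y ∈ X θ, f (xstar θ) ≤ f y) :
    ∃ (K : ℕ) (R : Fin K → Set (Fin m₁ → ℝ))
      (M : Fin K → Matrix (Fin n) (Fin m₁) ℝ) (c : Fin K → (Fin n → ℝ)),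
      (∀ j, Convex ℝ (R j)) ∧
      Θf = ⋃ j, R j ∧
      ∀ j, ∀ θ ∈ R j, xstar θ = (M j).mulVec θ + c j := by
  obtain rfl : X = fun θ ↦ polyhedron Ae (be + θ) AC bC := funext hX
  obtain rfl : f = quadObjective Q C := funext hf
  have hmem : ∀ θ ∈ Θf, xstar θ ∈ polyhedron Ae (be + θ) AC bC := fun θ hθ ↦ (hxstar θ hθ).1
  have hmin : ∀ θ ∈ Θf, IsMinOn (quadObjective Q C) (polyhedron Ae (be + θ) AC bC) (xstar θ) :=
    fun θ hθ ↦ isMinOn_iff.2 (hxstar θ hθ).2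
  let e : Set (Fin m₂) ≃ Fin (Nat.card (Set (Fin m₂))) := Finite.equivFin _
  let R (A : Set (Fin m₂)) : Set (Fin m₁ → ℝ) := {θ ∈ Θf | activeSet AC bC (xstar θ) = A}
  have haff (A : Set (Fin m₂)) : ∃ (M : Matrix (Fin n) (Fin m₁) ℝ) (c : Fin n → ℝ),
      ∀ θ ∈ R A, xstar θ = M *ᵥ θ + c := by
    obtain ⟨M, hM⟩ := exists_leftInverse_on_solutionDirections (Ae := Ae) (AC := AC) hQ A
    rcases (R A).eq_empty_or_nonempty with hR | ⟨θ₀, hθ₀, rfl⟩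
    · exact ⟨0, 0, by simp [hR]⟩
    · refine ⟨M, xstar θ₀ - M *ᵥ θ₀, fun θ ⟨hθ, hA⟩ ↦ ?_⟩
      have hsub := hM _ (sub_mem_solutionDirections hQ.posSemidef (hmem θ hθ) (hmem θ₀ hθ₀)
        (hmin θ hθ) (hmin θ₀ hθ₀) hA)
      rw [mulVec_sub, (hmem θ hθ).1, (hmem θ₀ hθ₀).1, add_sub_add_left_eq_sub, mulVec_sub] at hsub
      rw [add_sub_left_comm, hsub, add_sub_cancel]
  choose M c hMc using haff
  refine ⟨_, fun j ↦ R (e.symm j), fun j ↦ M (e.symm j), fun j ↦ c (e.symm j), fun j ↦ ?_, ?_,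
    fun j ↦ hMc _⟩
  · rintro θ ⟨hθ, hθA⟩ θ' ⟨hθ', hθA'⟩ s t hs ht hst
    obtain ⟨hz, hzA, hzmin⟩ := isMinOn_quadObjective_combo hQ.posSemidef (hmem θ hθ)
      (hmem θ' hθ') (hmin θ hθ) (hmin θ' hθ') (hθA.trans hθA'.symm) hs ht hst
    have hb : s • (be + θ) + t • (be + θ') = be + (s • θ + t • θ') := by
      obtain rfl : t = 1 - s := by linarith
      module
    rw [hb] at hz hzmin
    have hΘ : s • θ + t • θ' ∈ Θf := by
      rw [hΘf]
      exact ⟨_, hz⟩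
    refine ⟨hΘ, ?_⟩
    rw [eq_of_isMinOn_quadObjective hQ (hmem _ hΘ) hz (hmin _ hΘ) hzmin, hzA, hθA]
  · ext θ
    simp only [Set.mem_iUnion]
    exact ⟨fun hθ ↦ ⟨e (activeSet AC bC (xstar θ)), hθ, (e.symm_apply_apply _).symm⟩,
      fun ⟨_, hθ, _⟩ ↦ hθ⟩
end

section
/- The optimal value function z : Θ_f → ℝ defined by z(θ) = x*(θ)ᵀQ x*(θ) + Cᵀx*(θ) is continuous on Θ_f. -/
open Matrix

/-- A linear map between finite-dimensional spaces is bounded below on the orthogonal complement of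
its kernel. -/
lemma LinearMap.exists_norm_le_mul_of_mem_orthogonal_ker {E F : Type*} [NormedAddCommGroup E]
    [InnerProductSpace ℝ E] [FiniteDimensional ℝ E] [NormedAddCommGroup F] [NormedSpace ℝ F]
    (B : E →ₗ[ℝ] F) :
    ∃ M : ℝ, 0 ≤ M ∧ ∀ x ∈ (LinearMap.ker B)ᗮ, ‖x‖ ≤ M * ‖B x‖ := by
  have hker : LinearMap.ker (B.domRestrict (LinearMap.ker B)ᗮ) = ⊥ := by
    rw [LinearMap.ker_eq_bot']
    rintro ⟨x, hx⟩ h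
    have hxk : x ∈ LinearMap.ker B := h
    have := (Submodule.mem_orthogonal _ _).1 hx x hxk
    exact Subtype.ext (inner_self_eq_zero.1 this)
  obtain ⟨K, -, hK⟩ := LinearMap.exists_antilipschitzWith _ hker
  refine ⟨K, K.2, fun x hx => ?_⟩
  simpa using hK.le_mul_dist ⟨x, hx⟩ 0

/-- A linear map restricted to a polyhedral cone admits preimages of linearly bounded norm. -/
lemma exists_norm_le_mul_of_polyhedral_cone {E F ι : Type*} [Finite ι] [NormedAddCommGroup E]
    [InnerProductSpace ℝ E] [FiniteDimensional ℝ E] [NormedAddCommGroup F] [NormedSpace ℝ F]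
    (A : E →L[ℝ] F) (φ : ι → E →L[ℝ] ℝ) :
    ∃ M : ℝ, ∀ d, (∀ i, φ i d ≤ 0) →
      ∃ k, A k = A d ∧ (∀ i, φ i k ≤ 0) ∧ ‖k‖ ≤ M * ‖A d‖ := by
  classical
  have := Fintype.ofFinite ι
  let B : Finset ι → E →ₗ[ℝ] F × (ι → ℝ) := fun I =>
    A.toLinearMap.prod (LinearMap.pi fun i => if i ∈ I then (φ i).toLinearMap else 0)
  choose M hM0 hM using fun I => (B I).exists_norm_le_mul_of_mem_orthogonal_ker
  refine ⟨∑ I, M I, fun d hd => ?_⟩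
  let S : Set E := {k | A k = A d ∧ ∀ i, φ i k ≤ 0}
  have hS : IsClosed S := by
    have hS' : S = {k | A k = A d} ∩ ⋂ i, {k | φ i k ≤ 0} := by ext; simp [S]
    rw [hS']
    exact (isClosed_eq A.continuous continuous_const).inter <|
      isClosed_iInter fun i => isClosed_le (φ i).continuous continuous_const
  obtain ⟨k, hkS, hk⟩ := hS.exists_infDist_eq_dist ⟨d, rfl, hd⟩ 0
  have hmin : ∀ y ∈ S, ‖k‖ ≤ ‖y‖ := fun y hy => by
    have := Metric.infDist_le_dist_of_mem (x := 0) hy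
    rwa [hk, dist_zero_left, dist_zero_left] at this
  refine ⟨k, hkS.1, hkS.2, ?_⟩
  let I : Finset ι := {i | φ i k = 0}
  have hBk : ‖B I k‖ ≤ ‖A d‖ := by
    have h0 : (B I k).2 = 0 := by
      ext i
      by_cases hi : φ i k = 0 <;> simp [B, I, hi]
    rw [Prod.norm_def, h0, norm_zero]
    simp [B, hkS.1]
  have horth : k ∈ (LinearMap.ker (B I))ᗮ := by
    rw [Submodule.mem_orthogonal]
    intro e he
    have hAe : A e = 0 := congrArg Prod.fst (LinearMap.mem_ker.1 he)
    have hφe : ∀ i, φ i k = 0 → φ i e = 0 := fun i hi => by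
      have := congrFun (congrArg Prod.snd (LinearMap.mem_ker.1 he)) i
      simpa [B, I, hi] using this
    have hev : ∀ᶠ t : ℝ in nhds 0, k + t • e ∈ S := by
      have : ∀ᶠ t : ℝ in nhds 0, ∀ i, φ i (k + t • e) ≤ 0 := by
        rw [Filter.eventually_all]
        intro i
        rcases (hkS.2 i).eq_or_lt with hi | hi
        · exact Filter.Eventually.of_forall fun t => by simp [hi, hφe i hi]
        · have hc : Continuous fun t : ℝ => φ i (k + t • e) := by fun_prop
          exact (hc.tendsto 0).eventually_le_const (by simpa using hi)
      filter_upwards [this] with t ht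
      exact ⟨by simp [hAe, hkS.1], ht⟩
    have hlocal : IsLocalMin (fun t : ℝ => ‖k + t • e‖ ^ 2) 0 := by
      filter_upwards [hev] with t ht
      have := hmin _ ht
      simp only [zero_smul, add_zero]
      gcongr
    have hderiv : HasDerivAt (fun t : ℝ => ‖k + t • e‖ ^ 2) (2 * inner ℝ k e) 0 := by
      have := (((hasDerivAt_id (0 : ℝ)).smul_const e).const_add k).norm_sq
      simpa using this
    have := hlocal.hasDerivAt_eq_zero hderiv
    rw [real_inner_comm]
    linarith
  calc ‖k‖ ≤ M I * ‖B I k‖ := hM I k horth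
    _ ≤ (∑ I, M I) * ‖A d‖ := by
      gcongr
      · exact Finset.sum_nonneg fun J _ => hM0 J
      · exact Finset.single_le_sum (fun J _ => hM0 J) (Finset.mem_univ I)

/-- Lower hemicontinuity of the feasible set of a system of linear equations and inequalities with
respect to the right-hand side of the equations. -/
lemma exists_tendsto_feasible {n m₁ m₂ : ℕ} (Ae : Matrix (Fin m₁) (Fin n) ℝ) (be : Fin m₁ → ℝ)
    (AC : Matrix (Fin m₂) (Fin n) ℝ) (bC : Fin m₂ → ℝ) {θ₀ : Fin m₁ → ℝ} {x₀ : Fin n → ℝ}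
    (hx₀ : Ae *ᵥ x₀ = be + θ₀ ∧ AC *ᵥ x₀ ≤ bC) {Θ : Set (Fin m₁ → ℝ)}
    (hΘ : ∀ θ ∈ Θ, ∃ x, Ae *ᵥ x = be + θ ∧ AC *ᵥ x ≤ bC) :
    ∃ u : (Fin m₁ → ℝ) → Fin n → ℝ, Filter.Tendsto u (nhdsWithin θ₀ Θ) (nhds x₀) ∧
      ∀ᶠ θ in nhdsWithin θ₀ Θ, Ae *ᵥ u θ = be + θ ∧ AC *ᵥ u θ ≤ bC := by
  let e := EuclideanSpace.equiv (Fin n) ℝ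
  let A : EuclideanSpace ℝ (Fin n) →L[ℝ] (Fin m₁ → ℝ) :=
    (LinearMap.toContinuousLinearMap Ae.mulVecLin).comp e.toContinuousLinearMap
  let φ : {i // (AC *ᵥ x₀) i = bC i} → EuclideanSpace ℝ (Fin n) →L[ℝ] ℝ := fun i =>
    (ContinuousLinearMap.proj i.1).comp
      ((LinearMap.toContinuousLinearMap AC.mulVecLin).comp e.toContinuousLinearMap)
  have hA : ∀ v, A v = Ae *ᵥ e v := fun _ => rfl
  have hφ : ∀ i v, φ i v = (AC *ᵥ e v) i.1 := fun _ _ => rfl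
  obtain ⟨M, hM⟩ := exists_norm_le_mul_of_polyhedral_cone A φ
  have hk : ∀ θ ∈ Θ, ∃ k, A k = θ - θ₀ ∧ (∀ i, φ i k ≤ 0) ∧ ‖k‖ ≤ M * ‖θ - θ₀‖ := by
    intro θ hθ
    obtain ⟨x, hx, hx'⟩ := hΘ θ hθ
    have hAx : A (e.symm (x - x₀)) = θ - θ₀ := by
      rw [hA, e.apply_symm_apply, Matrix.mulVec_sub, hx, hx₀.1]
      abel
    rw [← hAx]
    refine hM _ fun i => ?_
    rw [hφ, e.apply_symm_apply, Matrix.mulVec_sub, Pi.sub_apply, i.2]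
    exact sub_nonpos.2 (hx' i)
  choose! k hkA hkφ hkM using hk
  have hk0 : Filter.Tendsto k (nhdsWithin θ₀ Θ) (nhds 0) := by
    refine squeeze_zero_norm' (a := fun θ => M * ‖θ - θ₀‖)
      (Filter.eventually_of_mem self_mem_nhdsWithin hkM) ?_
    have hc : Continuous fun θ : Fin m₁ → ℝ => M * ‖θ - θ₀‖ := by fun_prop
    simpa using (hc.tendsto θ₀).mono_left nhdsWithin_le_nhds
  have hu : Filter.Tendsto (fun θ => x₀ + e (k θ)) (nhdsWithin θ₀ Θ) (nhds x₀) := by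
    simpa using ((e.continuous.tendsto 0).comp hk0).const_add x₀
  refine ⟨_, hu, ?_⟩
  have hev : ∀ᶠ θ in nhdsWithin θ₀ Θ, ∀ i, (AC *ᵥ (x₀ + e (k θ))) i ≤ bC i := by
    rw [Filter.eventually_all]
    intro i
    rcases (hx₀.2 i).eq_or_lt with hi | hi
    · filter_upwards [self_mem_nhdsWithin] with θ hθ
      have := hkφ θ hθ ⟨i, hi⟩
      rw [hφ] at this
      rw [Matrix.mulVec_add, Pi.add_apply, hi]
      linarith
    · have hc : Continuous fun x : Fin n → ℝ => (AC *ᵥ x) i := by fun_prop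
      exact ((hc.tendsto x₀).comp hu).eventually_le_const hi
  filter_upwards [hev, self_mem_nhdsWithin] with θ hθ hθΘ
  refine ⟨?_, hθ⟩
  rw [Matrix.mulVec_add, ← hA, hkA θ hθΘ, hx₀.1]
  abel

/-- A quadratic function with positive definite Hessian is coercive. -/
lemma Matrix.PosDef.isBounded_setOf_quadratic_le {n : ℕ} {Q : Matrix (Fin n) (Fin n) ℝ}
    (hQ : Q.PosDef) (C : Fin n → ℝ) (r : ℝ) :
    Bornology.IsBounded {x : Fin n → ℝ | x ⬝ᵥ Q *ᵥ x + C ⬝ᵥ x ≤ r} := by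
  have hc : Continuous fun x : Fin n → ℝ => x ⬝ᵥ Q *ᵥ x := by fun_prop
  obtain ⟨c, hc0, hcle⟩ := (isCompact_sphere (0 : Fin n → ℝ) 1).exists_forall_le' hc.continuousOn
    (a := 0) fun x hx => by
      have hx0 : x ≠ 0 := ne_zero_of_mem_unit_sphere ⟨x, hx⟩
      simpa using hQ.dotProduct_mulVec_pos hx0
  have hquad : ∀ x : Fin n → ℝ, c * ‖x‖ ^ 2 ≤ x ⬝ᵥ Q *ᵥ x := fun x => by
    rcases eq_or_ne x 0 with rfl | hx
    · simp
    · have hx' : 0 < ‖x‖ := norm_pos_iff.2 hx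
      have := hcle (‖x‖⁻¹ • x) (by simp [norm_smul, hx'.ne'])
      simp only [Matrix.mulVec_smul, dotProduct_smul, smul_dotProduct, smul_eq_mul] at this
      calc c * ‖x‖ ^ 2 ≤ (‖x‖⁻¹ * (‖x‖⁻¹ * x ⬝ᵥ Q *ᵥ x)) * ‖x‖ ^ 2 := by gcongr
        _ = x ⬝ᵥ Q *ᵥ x := by field_simp
  let L : (Fin n → ℝ) →L[ℝ] ℝ := LinearMap.toContinuousLinearMap (dotProductBilin ℝ ℝ C)
  have hL : ∀ x, -(‖L‖ * ‖x‖) ≤ C ⬝ᵥ x := fun x => neg_le_of_abs_le (L.le_opNorm x)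
  refine isBounded_iff_forall_norm_le.2 ⟨1 + (‖L‖ + |r|) / c, fun x hx => ?_⟩
  have hx : x ⬝ᵥ Q *ᵥ x + C ⬝ᵥ x ≤ r := hx
  by_contra! h
  have h1 : 1 < ‖x‖ := lt_of_le_of_lt (by simp; positivity) h
  have h2 : ‖L‖ + |r| < c * ‖x‖ := by
    rw [← div_lt_iff₀' hc0]
    linarith
  nlinarith [hquad x, hL x, le_abs_self r, abs_nonneg r]

/-- The optimal value function `z(θ) = x*(θ)ᵀ Q x*(θ) + Cᵀ x*(θ)` of the
mp-QP is continuous on the feasible parameter set. -/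
theorem qp_value_function_continuousOn
    (n m₁ m₂ : ℕ)
    (Q : Matrix (Fin n) (Fin n) ℝ) (hQ : Q.PosDef)
    (C : Fin n → ℝ)
    (Ae : Matrix (Fin m₁) (Fin n) ℝ) (be : Fin m₁ → ℝ)
    (AC : Matrix (Fin m₂) (Fin n) ℝ) (bC : Fin m₂ → ℝ)
    (X : (Fin m₁ → ℝ) → Set (Fin n → ℝ))
    (hX : ∀ θ, X θ = {x : Fin n → ℝ | Ae.mulVec x = be + θ ∧ AC.mulVec x ≤ bC})
    (f : (Fin n → ℝ) → ℝ)
    (hf : ∀ x, f x = x ⬝ᵥ Q.mulVec x + C ⬝ᵥ x)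
    (Θf : Set (Fin m₁ → ℝ)) (hΘf : Θf = {θ : Fin m₁ → ℝ | (X θ).Nonempty})
    (xstar : (Fin m₁ → ℝ) → (Fin n → ℝ))
    (hxstar : ∀ θ ∈ Θf, xstar θ ∈ X θ ∧ ∀ y ∈ X θ, f (xstar θ) ≤ f y)
    (z : (Fin m₁ → ℝ) → ℝ)
    (hz : ∀ θ, z θ = xstar θ ⬝ᵥ Q.mulVec (xstar θ) + C ⬝ᵥ xstar θ) :
    ContinuousOn z Θf := by
  have hXmem : ∀ θ x, x ∈ X θ ↔ Ae *ᵥ x = be + θ ∧ AC *ᵥ x ≤ bC := fun θ x => by rw [hX]; rfl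
  have hfun : f = fun x => x ⬝ᵥ Q *ᵥ x + C ⬝ᵥ x := funext hf
  have hfc : Continuous f := by rw [hfun]; fun_prop
  obtain rfl : z = fun θ => f (xstar θ) := funext fun θ => by rw [hz, hf]
  intro θ₀ hθ₀
  obtain ⟨hx₀, hmin⟩ := hxstar θ₀ hθ₀
  obtain ⟨u, hu, hfeas⟩ := exists_tendsto_feasible Ae be AC bC ((hXmem _ _).1 hx₀) (Θ := Θf)
    fun θ hθ => ⟨xstar θ, (hXmem _ _).1 (hxstar θ hθ).1⟩
  have hfu : Filter.Tendsto (fun θ => f (u θ)) (nhdsWithin θ₀ Θf) (nhds (f (xstar θ₀))) :=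
    (hfc.tendsto _).comp hu
  have hle : ∀ᶠ θ in nhdsWithin θ₀ Θf, f (xstar θ) ≤ f (u θ) := by
    filter_upwards [hfeas, self_mem_nhdsWithin] with θ h hθ
    exact (hxstar θ hθ).2 _ ((hXmem _ _).2 h)
  have hbdd : ∀ᶠ θ in nhdsWithin θ₀ Θf, f (xstar θ) ≤ f (xstar θ₀) + 1 := by
    filter_upwards [hle, hfu.eventually_le_const (lt_add_one _)] with θ h h'
    exact h.trans h'
  have hcomp : IsCompact (closure {x | f x ≤ f (xstar θ₀) + 1}) := by
    rw [hfun]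
    exact (hQ.isBounded_setOf_quadratic_le C _).isCompact_closure
  refine (Filter.tendsto_iff_ultrafilter _ _ _).2 fun g hg => ?_
  obtain ⟨y, -, hy⟩ := hcomp.ultrafilter_le_nhds (g.map xstar) <|
    Filter.le_principal_iff.2 <|
      (hbdd.filter_mono hg).mono fun θ (h : f (xstar θ) ≤ _) => subset_closure h
  have hy : Filter.Tendsto xstar g (nhds y) := hy
  have hfy : Filter.Tendsto (fun θ => f (xstar θ)) g (nhds (f y)) := (hfc.tendsto y).comp hy
  have hid : Filter.Tendsto id (g : Filter (Fin m₁ → ℝ)) (nhds θ₀) :=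
    hg.trans nhdsWithin_le_nhds
  have hstar : ∀ᶠ θ in (g : Filter (Fin m₁ → ℝ)),
      Ae *ᵥ xstar θ = be + θ ∧ AC *ᵥ xstar θ ≤ bC :=
    Filter.mem_of_superset (hg self_mem_nhdsWithin)
      fun θ h => (hXmem _ _).1 (hxstar θ h).1
  have hAe : Continuous fun x : Fin n → ℝ => Ae *ᵥ x := by fun_prop
  have hAC : Continuous fun x : Fin n → ℝ => AC *ᵥ x := by fun_prop
  have hyfeas : Ae *ᵥ y = be + θ₀ ∧ AC *ᵥ y ≤ bC := by
    constructor
    · exact tendsto_nhds_unique_of_eventuallyEq ((hAe.tendsto y).comp hy) (hid.const_add be)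
        (hstar.mono fun θ h => h.1)
    · exact le_of_tendsto ((hAC.tendsto y).comp hy) (hstar.mono fun θ h => h.2)
  have hyle := le_of_tendsto_of_tendsto hfy (hfu.mono_left hg) (hg hle)
  have hyeq := le_antisymm hyle (hmin y ((hXmem _ _).2 hyfeas))
  rwa [hyeq] at hfy
end

section
/- The optimal value function z : Θ_f → ℝ is piecewise quadratic: there exist K ∈ ℕ, convex sets R₁, …, R_K ⊆ ℝ^{m₁} with Θ_f = R₁ ∪ ⋯ ∪ R_K, symmetric matrices H₁, …, H_K ∈ ℝ^{m₁×m₁}, vectors g₁, …, g_K ∈ ℝ^{m₁} and scalars d₁, …, d_K ∈ ℝ such that for every j and every θ ∈ R_j, z(θ) = θᵀH_j θ + g_jᵀθ + d_j. -/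
open Matrix

/-- Second-order expansion of a quadratic function with symmetric Hessian. -/
lemma quadratic_add {n : ℕ} {Q : Matrix (Fin n) (Fin n) ℝ} (hQ : Q.IsSymm) (C x d : Fin n → ℝ) :
    (x + d) ⬝ᵥ Q.mulVec (x + d) + C ⬝ᵥ (x + d) =
      (x ⬝ᵥ Q.mulVec x + C ⬝ᵥ x) + ((2 : ℝ) • Q.mulVec x + C) ⬝ᵥ d + d ⬝ᵥ Q.mulVec d := by
  have h : x ⬝ᵥ Q.mulVec d = Q.mulVec x ⬝ᵥ d := by
    rw [dotProduct_mulVec, ← mulVec_transpose, hQ.eq]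
  simp only [mulVec_add, add_dotProduct, dotProduct_add, smul_dotProduct, smul_eq_mul, h,
    dotProduct_comm d (Q.mulVec x)]
  ring

/-- The points with active inequality set `S` at which the gradient of the objective is
nonnegative on every feasible direction. -/
def optimalPoints {n m₁ m₂ : ℕ} (Q : Matrix (Fin n) (Fin n) ℝ) (C : Fin n → ℝ)
    (Ae : Matrix (Fin m₁) (Fin n) ℝ) (AC : Matrix (Fin m₂) (Fin n) ℝ) (bC : Fin m₂ → ℝ)
    (S : Set (Fin m₂)) : Set (Fin n → ℝ) :=
  {x | (∀ i ∈ S, AC.mulVec x i = bC i) ∧ (∀ i ∉ S, AC.mulVec x i < bC i) ∧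
    ∀ d, Ae.mulVec d = 0 → (∀ i ∈ S, AC.mulVec d i ≤ 0) →
      0 ≤ ((2 : ℝ) • Q.mulVec x + C) ⬝ᵥ d}

section

variable {n m₁ m₂ : ℕ} {Q : Matrix (Fin n) (Fin n) ℝ} {C : Fin n → ℝ}
  {Ae : Matrix (Fin m₁) (Fin n) ℝ} {AC : Matrix (Fin m₂) (Fin n) ℝ} {bC : Fin m₂ → ℝ}
  {S : Set (Fin m₂)}

lemma convex_optimalPoints : Convex ℝ (optimalPoints Q C Ae AC bC S) := by
  rintro x ⟨hx₁, hx₂, hx₃⟩ y ⟨hy₁, hy₂, hy₃⟩ a b ha hb hab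
  have hAC (i) : AC.mulVec (a • x + b • y) i = a * AC.mulVec x i + b * AC.mulVec y i := by
    simp [mulVec_add, mulVec_smul]
  refine ⟨fun i hi => ?_, fun i hi => ?_, fun d hd hdS => ?_⟩
  · rw [hAC, hx₁ i hi, hy₁ i hi, ← add_mul, hab, one_mul]
  · rw [hAC]
    exact convex_Iio (bC i) (hx₂ i hi) (hy₂ i hi) ha hb hab
  · have h : ((2 : ℝ) • Q.mulVec (a • x + b • y) + C) ⬝ᵥ d =
        a * (((2 : ℝ) • Q.mulVec x + C) ⬝ᵥ d) + b * (((2 : ℝ) • Q.mulVec y + C) ⬝ᵥ d) := by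
      simp only [mulVec_add, mulVec_smul, add_dotProduct, smul_dotProduct, smul_eq_mul]
      linear_combination (-(C ⬝ᵥ d)) * hab
    rw [h]
    exact add_nonneg (mul_nonneg ha (hx₃ d hd hdS)) (mul_nonneg hb (hy₃ d hd hdS))

lemma Matrix.PosDef.isSymm_real (hQ : Q.PosDef) : Q.IsSymm := by
  simpa [IsSymm, IsHermitian, conjTranspose_eq_transpose_of_trivial] using hQ.isHermitian

lemma eq_of_mem_optimalPoints (hQ : Q.PosDef) {x y : Fin n → ℝ}
    (hx : x ∈ optimalPoints Q C Ae AC bC S) (hAe : Ae.mulVec y = Ae.mulVec x)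
    (hy : AC.mulVec y ≤ bC)
    (hyx : y ⬝ᵥ Q.mulVec y + C ⬝ᵥ y ≤ x ⬝ᵥ Q.mulVec x + C ⬝ᵥ x) : y = x := by
  by_contra hne
  have hpos : 0 < (y - x) ⬝ᵥ Q.mulVec (y - x) := by
    simpa using hQ.dotProduct_mulVec_pos (sub_ne_zero.2 hne)
  have hexp := quadratic_add hQ.isSymm_real C x (y - x)
  rw [add_sub_cancel] at hexp
  have hgrad := hx.2.2 (y - x) (by rw [mulVec_sub, hAe, sub_self]) fun i hi => by
    rw [mulVec_sub, Pi.sub_apply, hx.1 i hi]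
    exact sub_nonpos.2 (hy i)
  linarith

lemma le_of_mem_optimalPoints {x : Fin n → ℝ} (hx : x ∈ optimalPoints Q C Ae AC bC S) :
    AC.mulVec x ≤ bC := fun i => by
  by_cases hi : i ∈ S
  exacts [(hx.1 i hi).le, (hx.2.1 i hi).le]

open Filter Topology in
lemma mem_optimalPoints_of_isMin (hQ : Q.IsSymm) {x : Fin n → ℝ} (hx : AC.mulVec x ≤ bC)
    (hmin : ∀ y, Ae.mulVec y = Ae.mulVec x → AC.mulVec y ≤ bC →
      x ⬝ᵥ Q.mulVec x + C ⬝ᵥ x ≤ y ⬝ᵥ Q.mulVec y + C ⬝ᵥ y) :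
    x ∈ optimalPoints Q C Ae AC bC {i | AC.mulVec x i = bC i} := by
  refine ⟨fun i hi => hi, fun i hi => lt_of_le_of_ne (hx i) hi, fun d hd hdS => ?_⟩
  by_contra! hneg
  have hAC (t : ℝ) (i) : AC.mulVec (x + t • d) i = AC.mulVec x i + t * AC.mulVec d i := by
    simp [mulVec_add, mulVec_smul]
  have hlim (a b : ℝ) : Tendsto (fun t : ℝ => a + t * b) (𝓝[>] 0) (𝓝 a) := by
    have h : Tendsto (fun t : ℝ => a + t * b) (𝓝 0) (𝓝 (a + 0 * b)) :=
      Continuous.tendsto (by fun_prop) 0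
    simpa using h.mono_left nhdsWithin_le_nhds
  have hfeas : ∀ᶠ t : ℝ in 𝓝[>] 0, ∀ i, AC.mulVec (x + t • d) i ≤ bC i := by
    refine eventually_all.2 fun i => ?_
    by_cases hi : AC.mulVec x i = bC i
    · filter_upwards [self_mem_nhdsWithin] with t ht
      rw [hAC, hi]
      linarith [mul_nonpos_of_nonneg_of_nonpos (le_of_lt ht) (hdS i hi)]
    · filter_upwards [(hlim _ (AC.mulVec d i)).eventually_lt_const
        (lt_of_le_of_ne (hx i) hi)] with t ht
      rw [hAC]
      exact ht.le
  obtain ⟨t, hfeas, hdesc, ht⟩ := (hfeas.and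
    (((hlim _ (d ⬝ᵥ Q.mulVec d)).eventually_lt_const hneg).and self_mem_nhdsWithin)).exists
  have hle := hmin (x + t • d) (by simp [mulVec_add, mulVec_smul, hd]) hfeas
  rw [quadratic_add hQ] at hle
  simp only [mulVec_smul, dotProduct_smul, smul_dotProduct, smul_eq_mul] at hle
  have ht : 0 < t := ht
  nlinarith [mul_neg_of_pos_of_neg ht hdesc]

/-- On the points of a fixed active set, a point depends affinely on its image under the
equality constraint matrix. -/
lemma exists_affine_inverse_optimalPoints (hQ : Q.PosDef) :
    ∃ (G : Matrix (Fin n) (Fin m₁) ℝ) (c : Fin n → ℝ),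
      ∀ x ∈ optimalPoints Q C Ae AC bC S, x = G.mulVec (Ae.mulVec x) + c := by
  obtain hempty | ⟨x₀, hx₀⟩ := (optimalPoints Q C Ae AC bC S).eq_empty_or_nonempty
  · exact ⟨0, 0, by simp [hempty]⟩
  let W : Submodule ℝ (Fin n → ℝ) :=
    { carrier := {w | (∀ i ∈ S, AC.mulVec w i = 0) ∧
        ∀ d, Ae.mulVec d = 0 → (∀ i ∈ S, AC.mulVec d i = 0) → Q.mulVec w ⬝ᵥ d = 0}
      add_mem' := by
        rintro v w ⟨hv₁, hv₂⟩ ⟨hw₁, hw₂⟩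
        refine ⟨fun i hi => ?_, fun d hd hdS => ?_⟩
        · simp [mulVec_add, hv₁ i hi, hw₁ i hi]
        · simp [mulVec_add, add_dotProduct, hv₂ d hd hdS, hw₂ d hd hdS]
      zero_mem' := by simp
      smul_mem' := by
        rintro a w ⟨hw₁, hw₂⟩
        refine ⟨fun i hi => ?_, fun d hd hdS => ?_⟩
        · simp [mulVec_smul, hw₁ i hi]
        · simp [mulVec_smul, smul_dotProduct, hw₂ d hd hdS] }
  have hker : LinearMap.ker (Ae.mulVecLin.comp W.subtype) = ⊥ := by
    refine LinearMap.ker_eq_bot'.2 fun w hw => Subtype.ext ?_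
    have hw0 : Ae.mulVec (w : Fin n → ℝ) = 0 := by simpa using hw
    by_contra hne
    have hpos : 0 < (w : Fin n → ℝ) ⬝ᵥ Q.mulVec w := by
      simpa using hQ.dotProduct_mulVec_pos hne
    rw [dotProduct_comm, w.2.2 _ hw0 w.2.1] at hpos
    exact hpos.false
  obtain ⟨F, hF⟩ := LinearMap.exists_leftInverse_of_injective _ hker
  have hgrad {x d : Fin n → ℝ} (hx : x ∈ optimalPoints Q C Ae AC bC S)
      (hd : Ae.mulVec d = 0) (hdS : ∀ i ∈ S, AC.mulVec d i = 0) :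
      ((2 : ℝ) • Q.mulVec x + C) ⬝ᵥ d = 0 := by
    refine le_antisymm ?_ (hx.2.2 d hd fun i hi => (hdS i hi).le)
    have h := hx.2.2 (-d) (by simp [mulVec_neg, hd])
      fun i hi => by simp [mulVec_neg, hdS i hi]
    rwa [dotProduct_neg, neg_nonneg] at h
  have hW {x : Fin n → ℝ} (hx : x ∈ optimalPoints Q C Ae AC bC S) : x - x₀ ∈ W := by
    refine ⟨fun i hi => ?_, fun d hd hdS => ?_⟩
    · rw [mulVec_sub, Pi.sub_apply, hx.1 i hi, hx₀.1 i hi, sub_self]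
    · have h := hgrad hx hd hdS
      have h₀ := hgrad hx₀ hd hdS
      simp only [add_dotProduct, smul_dotProduct, smul_eq_mul] at h h₀
      rw [mulVec_sub, sub_dotProduct]
      linarith
  let G := LinearMap.toMatrix' (W.subtype.comp F)
  refine ⟨G, x₀ - G.mulVec (Ae.mulVec x₀), fun x hx => ?_⟩
  have hinv : G.mulVec (Ae.mulVec (x - x₀)) = x - x₀ := by
    have h := congrArg W.subtype (LinearMap.congr_fun hF ⟨x - x₀, hW hx⟩)
    rw [LinearMap.toMatrix'_mulVec]
    exact h
  rw [mulVec_sub, mulVec_sub] at hinv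
  rw [← add_sub_assoc, add_sub_right_comm, hinv, sub_add_cancel]

end

lemma quadratic_comp_affine {n m : ℕ} {Q : Matrix (Fin n) (Fin n) ℝ} (hQ : Q.IsSymm)
    (C c : Fin n → ℝ) (G : Matrix (Fin n) (Fin m) ℝ) (θ : Fin m → ℝ) :
    (c + G.mulVec θ) ⬝ᵥ Q.mulVec (c + G.mulVec θ) + C ⬝ᵥ (c + G.mulVec θ) =
      θ ⬝ᵥ (Gᵀ * Q * G).mulVec θ + Gᵀ.mulVec ((2 : ℝ) • Q.mulVec c + C) ⬝ᵥ θ +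
        (c ⬝ᵥ Q.mulVec c + C ⬝ᵥ c) := by
  have h₁ : θ ⬝ᵥ (Gᵀ * Q * G).mulVec θ = G.mulVec θ ⬝ᵥ Q.mulVec (G.mulVec θ) := by
    rw [← mulVec_mulVec, ← mulVec_mulVec, dotProduct_mulVec, vecMul_transpose]
  have h₂ : Gᵀ.mulVec ((2 : ℝ) • Q.mulVec c + C) ⬝ᵥ θ =
      ((2 : ℝ) • Q.mulVec c + C) ⬝ᵥ G.mulVec θ := by
    rw [mulVec_transpose, ← dotProduct_mulVec]
  rw [quadratic_add hQ, h₁, h₂]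
  ring

/-- The optimal value function `z` of the mp-QP is piecewise quadratic:
the feasible parameter set is a finite union of convex regions on each of
which `z(θ) = θᵀ H_j θ + g_jᵀ θ + d_j` with `H_j` symmetric. -/
theorem qp_value_function_piecewise_quadratic
    (n m₁ m₂ : ℕ)
    (Q : Matrix (Fin n) (Fin n) ℝ) (hQ : Q.PosDef)
    (C : Fin n → ℝ)
    (Ae : Matrix (Fin m₁) (Fin n) ℝ) (be : Fin m₁ → ℝ)
    (AC : Matrix (Fin m₂) (Fin n) ℝ) (bC : Fin m₂ → ℝ)
    (X : (Fin m₁ → ℝ) → Set (Fin n → ℝ))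
    (hX : ∀ θ, X θ = {x : Fin n → ℝ | Ae.mulVec x = be + θ ∧ AC.mulVec x ≤ bC})
    (f : (Fin n → ℝ) → ℝ)
    (hf : ∀ x, f x = x ⬝ᵥ Q.mulVec x + C ⬝ᵥ x)
    (Θf : Set (Fin m₁ → ℝ)) (hΘf : Θf = {θ : Fin m₁ → ℝ | (X θ).Nonempty})
    (xstar : (Fin m₁ → ℝ) → (Fin n → ℝ))
    (hxstar : ∀ θ ∈ Θf, xstar θ ∈ X θ ∧ ∀ y ∈ X θ, f (xstar θ) ≤ f y)
    (z : (Fin m₁ → ℝ) → ℝ)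
    (hz : ∀ θ, z θ = xstar θ ⬝ᵥ Q.mulVec (xstar θ) + C ⬝ᵥ xstar θ) :
    ∃ (K : ℕ) (R : Fin K → Set (Fin m₁ → ℝ))
      (H : Fin K → Matrix (Fin m₁) (Fin m₁) ℝ)
      (g : Fin K → (Fin m₁ → ℝ)) (d : Fin K → ℝ),
      (∀ j, Convex ℝ (R j)) ∧
      (∀ j, (H j).IsSymm) ∧
      Θf = ⋃ j, R j ∧
      ∀ j, ∀ θ ∈ R j, z θ = θ ⬝ᵥ (H j).mulVec θ + g j ⬝ᵥ θ + d j := by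
  have hsymm := hQ.isSymm_real
  choose G c hGc using fun S : Set (Fin m₂) =>
    exists_affine_inverse_optimalPoints (C := C) (Ae := Ae) (AC := AC) (bC := bC) (S := S) hQ
  let R (S : Set (Fin m₂)) : Set (Fin m₁ → ℝ) :=
    (fun x => Ae.mulVec x - be) '' optimalPoints Q C Ae AC bC S
  have hmem {θ : Fin m₁ → ℝ} (hθ : θ ∈ Θf) : θ ∈ R {i | AC.mulVec (xstar θ) i = bC i} := by
    obtain ⟨hfeas, hmin⟩ := hxstar θ hθ
    simp only [hX, Set.mem_ofPred_eq, hf] at hfeas hmin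
    refine ⟨xstar θ, mem_optimalPoints_of_isMin hsymm hfeas.2
      fun y hy hyC => hmin y ⟨hy.trans hfeas.1, hyC⟩, ?_⟩
    simp [hfeas.1]
  have hfeasible {S : Set (Fin m₂)} {x : Fin n → ℝ} (hx : x ∈ optimalPoints Q C Ae AC bC S) :
      x ∈ X (Ae.mulVec x - be) := by
    rw [hX]
    exact ⟨by simp, le_of_mem_optimalPoints hx⟩
  have hsub (S : Set (Fin m₂)) : R S ⊆ Θf := by
    rintro _ ⟨x, hx, rfl⟩
    rw [hΘf]
    exact ⟨x, hfeasible hx⟩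
  have hxstar_eq {S : Set (Fin m₂)} {x : Fin n → ℝ} (hx : x ∈ optimalPoints Q C Ae AC bC S) :
      xstar (Ae.mulVec x - be) = x := by
    obtain ⟨hfeas, hmin⟩ := hxstar _ (hsub S ⟨x, hx, rfl⟩)
    have hle := hmin x (hfeasible hx)
    rw [hX] at hfeas
    rw [hf, hf] at hle
    exact eq_of_mem_optimalPoints hQ hx (by simpa using hfeas.1) hfeas.2 hle
  have e := Finite.equivFin (Set (Fin m₂))
  let c' (S : Set (Fin m₂)) : Fin n → ℝ := (G S).mulVec be + c S
  refine ⟨_, fun j => R (e.symm j), fun j => (G (e.symm j))ᵀ * Q * G (e.symm j),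
    fun j => (G (e.symm j))ᵀ.mulVec ((2 : ℝ) • Q.mulVec (c' (e.symm j)) + C),
    fun j => c' (e.symm j) ⬝ᵥ Q.mulVec (c' (e.symm j)) + C ⬝ᵥ c' (e.symm j),
    fun j => ?_, fun j => ?_, ?_, ?_⟩
  · have h := (convex_optimalPoints (Q := Q) (C := C) (Ae := Ae) (AC := AC) (bC := bC)
      (S := e.symm j)).linear_image Ae.mulVecLin |>.translate (-be)
    simpa [R, Set.image_image, sub_eq_neg_add] using h
  · simp [IsSymm, transpose_mul, hsymm.eq, Matrix.mul_assoc]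
  · refine Set.Subset.antisymm (fun θ hθ => ?_) (Set.iUnion_subset fun j => hsub _)
    exact Set.mem_iUnion.2 ⟨e {i | AC.mulVec (xstar θ) i = bC i}, by simpa using hmem hθ⟩
  · rintro j _ ⟨x, hx, rfl⟩
    have hxc : c' (e.symm j) + (G (e.symm j)).mulVec (Ae.mulVec x - be) = x := by
      conv_rhs => rw [hGc _ x hx]
      simp only [c', mulVec_sub]
      abel
    rw [hz, hxstar_eq hx, ← quadratic_comp_affine hsymm, hxc]
end

section
/- Let B ⊆ {1, …, m₂} be a set of inequality-constraint indices, let A_B ∈ ℝ^{|B|×n} and b_B ∈ ℝ^{|B|} be the rows of A_C and entries of b_C indexed by B, and suppose the stacked matrix [A_e; A_B] ∈ ℝ^{(m₁+|B|)×n} has full row rank. Let J_B = [[2Q, Ãᵀ], [Ã, 0]] with Ã = [A_e; A_B], which is invertible. Let S ⊆ Θ_f, and suppose that for every θ ∈ S there is a triple (x(θ), λ(θ), μ(θ)) satisfying the KKT conditions for QP(θ) with μ_i(θ) = 0 for all i ∉ B and (A_C x(θ))_i = (b_C)_i for all i ∈ B. Then for every θ ∈ S the stacked vector (x(θ), λ(θ),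 (μ(θ))_B) equals J_B⁻¹ · (−C, b_e + θ, b_B); in particular, θ ↦ x(θ), θ ↦ λ(θ) and θ ↦ μ(θ) are restrictions to S of affine functions of θ. -/
open Matrix

/-- A matrix of full row rank has a transpose with injective `mulVec`. -/
theorem Matrix.transpose_mulVec_injective_of_rank_eq_card {ι κ K : Type*} [Fintype ι] [Fintype κ]
    [Field K] (A : Matrix ι κ K) (h : A.rank = Fintype.card ι) :
    Function.Injective Aᵀ.mulVec := by
  have hli : LinearIndependent K A.row := by
    rw [linearIndependent_iff_card_eq_finrank_span, ← h, A.rank_eq_finrank_span_row]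
    rfl
  intro v w hvw
  apply Matrix.vecMul_injective_iff.mpr hli
  simpa only [Matrix.mulVec_transpose] using hvw

/-- A saddle-point (KKT) matrix with positive definite leading block and constraint block of full
row rank is invertible. -/
theorem Matrix.isUnit_fromBlocks_of_posDef_of_rank_eq_card {ι κ : Type*} [Fintype ι] [Fintype κ]
    [DecidableEq ι] [DecidableEq κ] {P : Matrix κ κ ℝ} (hP : P.PosDef) (A : Matrix ι κ ℝ)
    (h : A.rank = Fintype.card ι) : IsUnit (Matrix.fromBlocks P Aᵀ A 0) := by
  rw [← Matrix.mulVec_injective_iff_isUnit]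
  change Function.Injective (Matrix.fromBlocks P Aᵀ A 0).mulVecLin
  rw [injective_iff_map_eq_zero]
  intro z hz
  rw [Matrix.mulVecLin_apply, Matrix.fromBlocks_mulVec] at hz
  have h₁ : P *ᵥ (z ∘ Sum.inl) + Aᵀ *ᵥ (z ∘ Sum.inr) = 0 := by
    ext i
    simpa using congrFun hz (Sum.inl i)
  have h₂ : A *ᵥ (z ∘ Sum.inl) = 0 := by
    ext i
    simpa using congrFun hz (Sum.inr i)
  have hu : z ∘ Sum.inl = 0 := by
    by_contra hne
    have hpos := hP.dotProduct_mulVec_pos hne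
    have hdot := congrArg (fun w => (z ∘ Sum.inl) ⬝ᵥ w) h₁
    simp only [dotProduct_add, Matrix.dotProduct_mulVec _ Aᵀ, Matrix.vecMul_transpose, h₂,
      zero_dotProduct, add_zero, dotProduct_zero] at hdot
    rw [star_trivial, hdot] at hpos
    exact lt_irrefl _ hpos
  have hv : z ∘ Sum.inr = 0 := by
    apply A.transpose_mulVec_injective_of_rank_eq_card h
    simpa [hu] using h₁
  ext (i | i)
  · exact congrFun hu i
  · exact congrFun hv i

/-- If `w` vanishes off `B`, only the rows of `A` indexed by `B` contribute to `Aᵀ *ᵥ w`. -/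
theorem Matrix.transpose_mulVec_eq_submatrix_of_eq_zero {ι κ K : Type*} [Fintype ι] [CommRing K]
    (A : Matrix ι κ K) (B : Finset ι) (w : ι → K) (hw : ∀ i ∉ B, w i = 0) :
    Aᵀ *ᵥ w =
      (A.submatrix (fun i : {i : ι // i ∈ B} => (i : ι)) id)ᵀ *ᵥ
        (fun i : {i : ι // i ∈ B} => w i) := by
  ext j
  simp only [Matrix.mulVec, dotProduct, Matrix.transpose_apply, Matrix.submatrix_apply, id]
  rw [Finset.sum_coe_sort B (fun i => A i j * w i)]
  refine (Finset.sum_subset (Finset.subset_univ B) fun i _ hi => ?_).symm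
  rw [hw i hi, mul_zero]

/-- Translating the middle block of a vector changes its image under `J` by a linear term. -/
theorem Matrix.mulVec_sumElim_add {ρ α β γ K : Type*} [Fintype α] [Fintype β] [Fintype γ]
    [CommRing K] (J : Matrix ρ (α ⊕ (β ⊕ γ)) K) (a : α → K) (b t : β → K) (c : γ → K) :
    J *ᵥ Sum.elim a (Sum.elim (b + t) c) =
      J.submatrix id (fun j => Sum.inr (Sum.inl j)) *ᵥ t + J *ᵥ Sum.elim a (Sum.elim b c) := by
  ext i
  simp only [Matrix.mulVec, dotProduct, Fintype.sum_sum_type, Sum.elim_inl, Sum.elim_inr,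
    Pi.add_apply, mul_add, Finset.sum_add_distrib, Matrix.submatrix_apply, id]
  ring

/-- On a critical region with active set `B`, every KKT solution of `QP(θ)`
(with multipliers vanishing off `B` and the constraints in `B` active) is
given by the linear system `J_B (x, λ, μ_B) = (−C, b_e + θ, b_B)`; in
particular `x(θ)`, `λ(θ)` and `μ(θ)` are restrictions of affine functions. -/
theorem active_set_affine_solution
    (n m₁ m₂ : ℕ)
    (Q : Matrix (Fin n) (Fin n) ℝ) (hQ : Q.PosDef)
    (C : Fin n → ℝ)
    (Ae : Matrix (Fin m₁) (Fin n) ℝ) (be : Fin m₁ → ℝ)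
    (AC : Matrix (Fin m₂) (Fin n) ℝ) (bC : Fin m₂ → ℝ)
    (B : Finset (Fin m₂))
    (Atil : Matrix (Fin m₁ ⊕ {i : Fin m₂ // i ∈ B}) (Fin n) ℝ)
    (hAtil : Atil = Matrix.fromRows Ae
      (AC.submatrix (fun i : {i : Fin m₂ // i ∈ B} => (i : Fin m₂)) id))
    (hrank : Atil.rank = m₁ + B.card)
    (JB : Matrix ((Fin n) ⊕ (Fin m₁ ⊕ {i : Fin m₂ // i ∈ B}))
      ((Fin n) ⊕ (Fin m₁ ⊕ {i : Fin m₂ // i ∈ B})) ℝ)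
    (hJB : JB = Matrix.fromBlocks ((2 : ℝ) • Q) Atil.transpose Atil 0)
    (S : Set (Fin m₁ → ℝ))
    (hS : S ⊆ {θ : Fin m₁ → ℝ |
      ∃ x : Fin n → ℝ, Ae.mulVec x = be + θ ∧ AC.mulVec x ≤ bC})
    (x : (Fin m₁ → ℝ) → (Fin n → ℝ))
    (lam : (Fin m₁ → ℝ) → (Fin m₁ → ℝ))
    (μ : (Fin m₁ → ℝ) → (Fin m₂ → ℝ))
    (hkkt : ∀ θ ∈ S,
      ((2 : ℝ) • Q.mulVec (x θ) + C + Ae.transpose.mulVec (lam θ)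
        + AC.transpose.mulVec (μ θ) = 0) ∧
      Ae.mulVec (x θ) = be + θ ∧
      AC.mulVec (x θ) ≤ bC ∧
      0 ≤ μ θ ∧
      (∀ i, μ θ i * (AC.mulVec (x θ) - bC) i = 0) ∧
      (∀ i ∉ B, μ θ i = 0) ∧
      (∀ i ∈ B, AC.mulVec (x θ) i = bC i)) :
    IsUnit JB ∧
    (∀ θ ∈ S,
      Sum.elim (x θ) (Sum.elim (lam θ) (fun i : {i : Fin m₂ // i ∈ B} => μ θ i))
        = JB⁻¹.mulVec (Sum.elim (-C)
            (Sum.elim (be + θ) (fun i : {i : Fin m₂ // i ∈ B} => bC i)))) ∧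
    (∃ (M : Matrix (Fin n) (Fin m₁) ℝ) (c : Fin n → ℝ),
      ∀ θ ∈ S, x θ = M.mulVec θ + c) ∧
    (∃ (M : Matrix (Fin m₁) (Fin m₁) ℝ) (c : Fin m₁ → ℝ),
      ∀ θ ∈ S, lam θ = M.mulVec θ + c) ∧
    (∃ (M : Matrix (Fin m₂) (Fin m₁) ℝ) (c : Fin m₂ → ℝ),
      ∀ θ ∈ S, μ θ = M.mulVec θ + c) := by
  have hunit : IsUnit JB := by
    rw [hJB]
    refine Matrix.isUnit_fromBlocks_of_posDef_of_rank_eq_card (hQ.smul two_pos) Atil ?_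
    simpa using hrank
  have hsol : ∀ θ ∈ S,
      Sum.elim (x θ) (Sum.elim (lam θ) (fun i : {i : Fin m₂ // i ∈ B} => μ θ i))
        = JB⁻¹.mulVec (Sum.elim (-C)
            (Sum.elim (be + θ) (fun i : {i : Fin m₂ // i ∈ B} => bC i))) := by
    intro θ hθ
    obtain ⟨hstat, heq, -, -, -, hoff, hact⟩ := hkkt θ hθ
    have hlin : JB *ᵥ
        Sum.elim (x θ) (Sum.elim (lam θ) (fun i : {i : Fin m₂ // i ∈ B} => μ θ i)) =
        Sum.elim (-C) (Sum.elim (be + θ) (fun i : {i : Fin m₂ // i ∈ B} => bC i)) := by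
      rw [AC.transpose_mulVec_eq_submatrix_of_eq_zero B _ hoff] at hstat
      rw [hJB, hAtil, Matrix.fromBlocks_mulVec, Sum.elim_comp_inl, Sum.elim_comp_inr,
        Matrix.transpose_fromRows, Matrix.fromCols_mulVec, Matrix.fromRows_mulVec,
        Sum.elim_comp_inl, Sum.elim_comp_inr, Matrix.zero_mulVec, add_zero, heq,
        Matrix.smul_mulVec]
      congr 1
      · rw [eq_neg_iff_add_eq_zero, ← hstat]
        abel
      · congr 1
        ext i
        exact hact i i.2
    rw [← hlin, Matrix.mulVec_mulVec,
      Matrix.nonsing_inv_mul _ ((Matrix.isUnit_iff_isUnit_det _).mp hunit), Matrix.one_mulVec]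
  set M := JB⁻¹.submatrix id (fun j : Fin m₁ => Sum.inr (Sum.inl j))
  set c := JB⁻¹ *ᵥ Sum.elim (-C) (Sum.elim be (fun i : {i : Fin m₂ // i ∈ B} => bC i))
  have haff : ∀ θ ∈ S,
      Sum.elim (x θ) (Sum.elim (lam θ) (fun i : {i : Fin m₂ // i ∈ B} => μ θ i)) =
        M *ᵥ θ + c := fun θ hθ => (hsol θ hθ).trans (Matrix.mulVec_sumElim_add _ _ _ _ _)
  refine ⟨hunit, hsol, ⟨M.submatrix Sum.inl id, c ∘ Sum.inl, fun θ hθ => ?_⟩,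
    ⟨M.submatrix (Sum.inr ∘ Sum.inl) id, c ∘ Sum.inr ∘ Sum.inl, fun θ hθ => ?_⟩,
    ⟨Matrix.of fun i j => if h : i ∈ B then M (Sum.inr (Sum.inr ⟨i, h⟩)) j else 0,
      fun i => if h : i ∈ B then c (Sum.inr (Sum.inr ⟨i, h⟩)) else 0, fun θ hθ => ?_⟩⟩
  · ext i
    exact congrFun (haff θ hθ) (Sum.inl i)
  · ext i
    exact congrFun (haff θ hθ) (Sum.inr (Sum.inl i))
  · ext i
    by_cases h : i ∈ B
    · have hi := congrFun (haff θ hθ) (Sum.inr (Sum.inr ⟨i, h⟩))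
      simpa [h, Matrix.mulVec, dotProduct] using hi
    · obtain ⟨-, -, -, -, -, hoff, -⟩ := hkkt θ hθ
      simp [h, hoff i h, Matrix.mulVec, dotProduct]
end
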